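/- Let L be an algebraically closed field of prime characteristic. Then the polynomial p(X,t) = X⁴ − t²(t−2)X³ + (−t⁵ + 3t⁴ − 2t³ + 2t + 1)X² + t³(t−2)(t²−2t−1)X + t²(t²−2t−1)² is irreducible in the two-variable polynomial ring L[X,t]. -/

import Mathlib

open MvPolynomial

noncomputable section

/-- The polynomial
`p(x,t) = x⁴ − t²(t−2)x³ + (−t⁵+3t⁴−2t³+2t+1)x² + t³(t−2)(t²−2t−1)x + t²(t²−2t−1)²`
in `L[x,t]`, with `x = X 0` and `t = X 1`. -/
def pPoly (L : Type*) [CommRing L] : MvPolynomial (Fin 2) L :=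
  let x : MvPolynomial (Fin 2) L := X 0
  let t : MvPolynomial (Fin 2) L := X 1
  x ^ 4 - t ^ 2 * (t - 2) * x ^ 3 + (-t ^ 5 + 3 * t ^ 4 - 2 * t ^ 3 + 2 * t + 1) * x ^ 2
    + t ^ 3 * (t - 2) * (t ^ 2 - 2 * t - 1) * x + t ^ 2 * (t ^ 2 - 2 * t - 1) ^ 2

namespace PAux

open Polynomial

variable {L : Type*} [Field L]

/-- `t²(t-2)` -/
def aa (L : Type*) [Field L] : L[X] := Polynomial.X ^ 2 * (Polynomial.X - 2)
/-- the `X²` coefficient -/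
def bb (L : Type*) [Field L] : L[X] :=
  -Polynomial.X ^ 5 + 3 * Polynomial.X ^ 4 - 2 * Polynomial.X ^ 3 + 2 * Polynomial.X + 1
/-- `t(t²-2t-1)` -/
def mm (L : Type*) [Field L] : L[X] :=
  Polynomial.X * (Polynomial.X ^ 2 - 2 * Polynomial.X - 1)

/-- explicit polynomial of degree at most five -/
def ex (e0 e1 e2 e3 e4 e5 : L) : L[X] :=
  Polynomial.C e5 * Polynomial.X ^ 5 + Polynomial.C e4 * Polynomial.X ^ 4 +
    Polynomial.C e3 * Polynomial.X ^ 3 + Polynomial.C e2 * Polynomial.X ^ 2 +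
    Polynomial.C e1 * Polynomial.X + Polynomial.C e0

lemma ex_coeff (e0 e1 e2 e3 e4 e5 : L) :
    (ex e0 e1 e2 e3 e4 e5).coeff 0 = e0 ∧ (ex e0 e1 e2 e3 e4 e5).coeff 1 = e1 ∧
    (ex e0 e1 e2 e3 e4 e5).coeff 2 = e2 ∧ (ex e0 e1 e2 e3 e4 e5).coeff 3 = e3 ∧
    (ex e0 e1 e2 e3 e4 e5).coeff 4 = e4 ∧ (ex e0 e1 e2 e3 e4 e5).coeff 5 = e5 := by
  simp [ex, Polynomial.coeff_X, Polynomial.coeff_C, Polynomial.coeff_X_pow]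

lemma ex_zero {e0 e1 e2 e3 e4 e5 : L} (h : ex e0 e1 e2 e3 e4 e5 = 0) :
    e0 = 0 ∧ e1 = 0 ∧ e2 = 0 ∧ e3 = 0 ∧ e4 = 0 ∧ e5 = 0 := by
  have := ex_coeff e0 e1 e2 e3 e4 e5
  rw [h] at this
  simp only [Polynomial.coeff_zero] at this
  obtain ⟨h0, h1, h2, h3, h4, h5⟩ := this
  exact ⟨h0.symm, h1.symm, h2.symm, h3.symm, h4.symm, h5.symm⟩

lemma deg_aa : (aa L).natDegree = 3 := by
  have : aa L = Polynomial.X ^ 3 - Polynomial.C 2 * Polynomial.X ^ 2 := by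
    simp only [aa, map_ofNat]; ring
  rw [this]; compute_degree!

lemma deg_mm : (mm L).natDegree = 3 := by
  have : mm L = Polynomial.X ^ 3 - Polynomial.C 2 * Polynomial.X ^ 2 - Polynomial.X := by
    simp only [mm, map_ofNat]; ring
  rw [this]; compute_degree!

lemma deg_bb : (bb L).natDegree = 5 := by
  have : bb L = -Polynomial.X ^ 5 + Polynomial.C 3 * Polynomial.X ^ 4
      - Polynomial.C 2 * Polynomial.X ^ 3 + Polynomial.C 2 * Polynomial.X + 1 := by
    simp only [bb, map_ofNat]
  rw [this]; compute_degree!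

lemma deg_q : (bb L + 2 * mm L).natDegree = 5 := by
  have : bb L + 2 * mm L = -Polynomial.X ^ 5 + Polynomial.C 3 * Polynomial.X ^ 4
      - Polynomial.C 4 * Polynomial.X ^ 2 + 1 := by
    simp only [bb, mm, map_ofNat]; ring
  rw [this]; compute_degree!

lemma ne_of_deg {f : L[X]} {n : ℕ} (h : f.natDegree = n) (hn : 0 < n) : f ≠ 0 := by
  rintro rfl; simp at h; omega

lemma quad_form {f : L[X]} (h : f.natDegree ≤ 2) :
    f = Polynomial.C (f.coeff 2) * Polynomial.X ^ 2 + Polynomial.C (f.coeff 1) * Polynomial.X +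
      Polynomial.C (f.coeff 0) := Polynomial.eq_quadratic_of_degree_le_two
        (Polynomial.natDegree_le_iff_degree_le.1 h)

lemma q_two (y z : L[X]) (hs : y + z = aa L) (hm : y * z = bb L + 2 * mm L)
    (hy : y.natDegree = 2) : False := by
  have hf := quad_form hy.le
  generalize y.coeff 2 = e at hf
  generalize y.coeff 1 = c at hf
  generalize y.coeff 0 = d at hf
  have hz : z = aa L - y := by rw [← hs]; ring
  subst hz
  have key : ex (-d^2-1) (-2*c*d) (-2*d-c^2-2*e*d+4) (d-2*c-2*e*c) (c-2*e-e^2-3) (e+1) = 0 := by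
    rw [← sub_eq_zero] at hm
    rw [← hm, hf]
    simp only [ex, aa, bb, mm, map_add, map_sub, map_mul, map_neg, map_pow, map_ofNat, map_one]
    ring
  obtain ⟨h0, h1, h2, h3, h4, h5⟩ := ex_zero key
  have he : e = -1 := by linear_combination h5
  subst he
  have hc : c = 2 := by linear_combination h4
  subst hc
  have hd : d = 0 := by linear_combination h3
  subst hd
  apply one_ne_zero (α := L)
  linear_combination -h0

lemma q_none (y z : L[X]) (hs : y + z = aa L) (hm : y * z = bb L + 2 * mm L) : False := by
  have hq := deg_q (L := L)
  have hq0 := ne_of_deg hq (by norm_num)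
  rw [← hm] at hq hq0
  have hy0 : y ≠ 0 := left_ne_zero_of_mul hq0
  have hz0 : z ≠ 0 := right_ne_zero_of_mul hq0
  rw [Polynomial.natDegree_mul hy0 hz0] at hq
  have ha := deg_aa (L := L)
  rw [← hs] at ha
  rcases lt_trichotomy y.natDegree z.natDegree with h | h | h
  · rw [Polynomial.natDegree_add_eq_right_of_natDegree_lt h] at ha
    exact q_two y z hs hm (by omega)
  · omega
  · rw [Polynomial.natDegree_add_eq_left_of_natDegree_lt h] at ha
    exact q_two z y (by rw [add_comm]; exact hs) (by rw [mul_comm]; exact hm) (by omega)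

lemma root_none (r : L[X])
    (h : r ^ 4 - aa L * r ^ 3 + bb L * r ^ 2 + aa L * mm L * r + mm L ^ 2 = 0) : False := by
  have hm0 : mm L ≠ 0 := ne_of_deg deg_mm (by norm_num)
  have hr0 : r ≠ 0 := by
    rintro rfl
    apply hm0
    simpa using h
  have hdvd : r ∣ mm L := by
    obtain ⟨u, v, hco, hu⟩ : ∃ u v : L[X], IsCoprime u v ∧ ∃ g, g ≠ 0 ∧ r = g * u ∧ mm L = g * v := by
      classical
      obtain ⟨u, hu⟩ := EuclideanDomain.gcd_dvd_left r (mm L)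
      obtain ⟨v, hv⟩ := EuclideanDomain.gcd_dvd_right r (mm L)
      have hab := EuclideanDomain.gcd_eq_gcd_ab r (mm L)
      have hg0 : EuclideanDomain.gcd r (mm L) ≠ 0 := fun h0 =>
        hr0 (EuclideanDomain.gcd_eq_zero_iff.1 h0).1
      generalize EuclideanDomain.gcdA r (mm L) = A at hab
      generalize EuclideanDomain.gcdB r (mm L) = B at hab
      generalize EuclideanDomain.gcd r (mm L) = g at *
      refine ⟨u, v, ⟨A, B, ?_⟩, g, hg0, hu, hv⟩
      apply mul_left_cancel₀ hg0
      linear_combination -hab - A * hu - B * hv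
    obtain ⟨g, hg, hr, hm⟩ := hu
    have h1 : g ^ 2 * (v ^ 2 + u * (aa L * v + bb L * u - aa L * u * r + u * r ^ 2)) = 0 := by
      rw [← h, hm, hr]; ring
    have h2 := (mul_eq_zero.1 h1).resolve_left (pow_ne_zero _ hg)
    have h3 : u ∣ v ^ 2 := ⟨-(aa L * v + bb L * u - aa L * u * r + u * r ^ 2), by
      linear_combination h2⟩
    have h4 : IsUnit u := (hco.pow_right (n := 2)).isUnit_of_dvd' dvd_rfl h3
    rw [hr, hm]
    exact mul_dvd_mul_left g (h4.dvd)
  obtain ⟨s, hs⟩ := hdvd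
  have h5 : r ^ 2 * (r ^ 2 - aa L * r + bb L + aa L * s + s ^ 2) = 0 := by
    rw [← h, hs]; ring
  have h6 := (mul_eq_zero.1 h5).resolve_left (pow_ne_zero _ hr0)
  refine q_none (r - s) (aa L - (r - s)) (by ring) ?_
  rw [hs]
  linear_combination -h6

lemma caseOne (α β δ : L[X]) (h1 : α * (mm L - β) = aa L * β)
    (h2 : β + δ - α * (aa L + α) = bb L) (h3 : β * δ = mm L ^ 2)
    (hα : α.natDegree = 1) (hβ : β.natDegree = 1) : False := by
  have hf := quad_form (f := α) (by omega)
  have hg := quad_form (f := β) (by omega)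
  have ha2 : α.coeff 2 = 0 := Polynomial.coeff_eq_zero_of_natDegree_lt (by omega)
  have hb2 : β.coeff 2 = 0 := Polynomial.coeff_eq_zero_of_natDegree_lt (by omega)
  have hb1 : β.coeff 1 ≠ 0 := by
    rw [← hβ]; exact Polynomial.leadingCoeff_ne_zero.2 (ne_of_deg hβ one_pos)
  have k1 := congrArg (fun f => Polynomial.coeff f 1) h3
  have k0 := congrArg (fun f => Polynomial.coeff f 0) h2
  simp [Polynomial.mul_coeff_one, Polynomial.mul_coeff_zero, mm, aa, bb, pow_two] at k0 k1
  rw [ha2] at hf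
  rw [hb2] at hg
  generalize α.coeff 1 = a1 at *
  generalize β.coeff 1 = b1 at *
  generalize α.coeff 0 = a0 at *
  generalize β.coeff 0 = b0 at *
  have key : ex (-a0*b0) (-a1*b0-a0*(1+b1)) (-2*a0-a1*(1+b1)+2*b0) (a0-2*a1-b0+2*b1) (a1-b1) 0
      = 0 := by
    rw [← sub_eq_zero] at h1
    rw [← h1, hf, hg]
    simp only [ex, aa, mm, map_add, map_sub, map_mul, map_neg, map_ofNat, map_one, map_zero]
    ring
  obtain ⟨e0, e1, e2, e3, e4, -⟩ := ex_zero key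
  have ha1 : a1 = b1 := by linear_combination e4
  subst ha1
  have ha0 : a0 = b0 := by linear_combination e3
  subst ha0
  have h5 : a1 * (1 + a1) = 0 := by linear_combination -e2
  have h6 := (mul_eq_zero.1 h5).resolve_left hb1
  have h7 : a1 = -1 := by linear_combination h6
  subst h7
  have h8 : a0 = 0 := by linear_combination e1
  subst h8
  simp at k0 k1
  rw [k1] at k0
  exact zero_ne_one k0

lemma caseTwo (α β δ : L[X]) (h1 : α * (mm L - β) = aa L * β)
    (h2 : β + δ - α * (aa L + α) = bb L) (h3 : β * δ = mm L ^ 2)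
    (hα : α.natDegree = 2) (hβ : β.natDegree = 2) (hδ : δ.natDegree = 4) : False := by
  have hf := quad_form (f := α) (by omega)
  have hg := quad_form (f := β) (by omega)
  have hd5 : δ.coeff 5 = 0 := Polynomial.coeff_eq_zero_of_natDegree_lt (by omega)
  have k1 := congrArg (fun f => Polynomial.coeff f 1) h3
  have k0 := congrArg (fun f => Polynomial.coeff f 0) h2
  simp [Polynomial.mul_coeff_one, Polynomial.mul_coeff_zero, mm, aa, bb, pow_two] at k0 k1
  generalize α.coeff 2 = a2 at *
  generalize β.coeff 2 = b2 at *
  generalize α.coeff 1 = a1 at *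
  generalize β.coeff 1 = c at *
  generalize α.coeff 0 = g at *
  generalize β.coeff 0 = d at *
  have key : ex (-g*d) (-a1*d-g*(1+c)) (-a2*d-a1*(1+c)-g*(2+b2)+2*d)
      (g-a1*(2+b2)-a2*(1+c)-d+2*c) (a1-a2*(2+b2)-c+2*b2) (a2-b2)
      = 0 := by
    rw [← sub_eq_zero] at h1
    rw [← h1, hf, hg]
    simp only [ex, aa, mm, map_add, map_sub, map_mul, map_neg, map_ofNat, map_one]
    ring
  obtain ⟨e0, e1, e2, e3, e4, e5⟩ := ex_zero key
  have hδ' : δ = ex (1+g^2-d) (2+2*a1*g-c) (a1^2+2*a2*g-2*g-b2) (-2+2*a2*a1+g-2*a1)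
      (3+a2^2+a1-2*a2) (-1+a2) := by
    have : δ = bb L - β + α * (aa L + α) := by linear_combination h2
    rw [this, hf, hg]
    simp only [ex, aa, bb, map_add, map_sub, map_mul, map_neg, map_ofNat, map_one, map_pow]
    ring
  have h5 := (ex_coeff (1+g^2-d) (2+2*a1*g-c) (a1^2+2*a2*g-2*g-b2) (-2+2*a2*a1+g-2*a1)
      (3+a2^2+a1-2*a2) (-1+a2)).2.2.2.2.2
  rw [← hδ', hd5] at h5
  have : a2 = 1 := by linear_combination -h5
  subst this
  have : b2 = 1 := by linear_combination -e5
  subst this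
  have : a1 = c + 1 := by linear_combination e4
  subst this
  have : g = d + 2 * c + 4 := by linear_combination e3
  have h0 : g * d = 0 := by linear_combination -e0
  rcases mul_eq_zero.1 h0 with hg0 | hd0
  · subst hg0
    have h6 : (c + 1) * d = 0 := by linear_combination -e1
    have hd0 : d ≠ 0 := by
      rintro rfl
      apply one_ne_zero (α := L)
      -- (c+1)² = 0 and 2c+4 = 0
      have h7 : (c + 1) ^ 2 = 0 := by linear_combination -e2
      have h8 : c + 1 = 0 := pow_eq_zero_iff (two_ne_zero) |>.1 h7
      have h9 : (2 : L) = 0 := by linear_combination -this - 2 * h8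
      have k : δ.coeff 0 = 0 := by
        have : c = -1 := by linear_combination h8
        rw [this] at k1; simpa using k1
      rw [k] at k0
      simp at k0
    have hc := (mul_eq_zero.1 h6).resolve_right hd0
    apply hd0
    linear_combination e2 + (c+1) * hc
  · subst hd0
    subst this
    have h6 : 2 * ((c + 1) * (c + 2)) = 0 := by linear_combination -e1
    have h7 : (c + 1) ^ 2 + 6 * (c + 2) = 0 := by linear_combination -e2
    have hc : c + 1 = 0 := by
      rcases mul_eq_zero.1 h6 with h | h
      · have h7 : (c + 1) ^ 2 = 0 := by linear_combination h7 - 3 * (c+2) * h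
        exact pow_eq_zero_iff (two_ne_zero) |>.1 h7
      · rcases mul_eq_zero.1 h with h | h
        · exact h
        · exfalso
          apply one_ne_zero (α := L)
          linear_combination h7 - (c + 6) * h
    have : c = -1 := by linear_combination hc
    subst this
    have k : δ.coeff 0 = 0 := by simpa using k1
    rw [k] at k0
    apply one_ne_zero (α := L)
    linear_combination h7 + k0

lemma side (α β γ δ : L[X]) (hs : α + γ = -aa L) (hb : β + δ + α * γ = bb L)
    (hp : β * δ = mm L ^ 2) (hx : α * mm L + γ * β = 0) (hle : β.natDegree ≤ δ.natDegree) :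
    False := by
  have da := deg_aa (L := L)
  have db := deg_bb (L := L)
  have dm := deg_mm (L := L)
  have hm0 : mm L ≠ 0 := ne_of_deg dm (by norm_num)
  have ha0 : aa L ≠ 0 := ne_of_deg da (by norm_num)
  have hp0 : β * δ ≠ 0 := by rw [hp]; exact pow_ne_zero _ hm0
  have hβ0 : β ≠ 0 := left_ne_zero_of_mul hp0
  have hδ0 : δ ≠ 0 := right_ne_zero_of_mul hp0
  have dsum : β.natDegree + δ.natDegree = 6 := by
    rw [← Polynomial.natDegree_mul hβ0 hδ0, hp, Polynomial.natDegree_pow, dm]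
  have h1 : α * (mm L - β) = aa L * β := by
    linear_combination hx - β * hs
  have hα0 : α ≠ 0 := by
    rintro rfl
    rw [zero_mul] at h1
    exact mul_ne_zero ha0 hβ0 h1.symm
  have hγ0 : γ ≠ 0 := by
    rintro rfl
    rw [zero_mul, add_zero] at hx
    exact mul_ne_zero hα0 hm0 hx
  have dx : α.natDegree + 3 = γ.natDegree + β.natDegree := by
    rw [← dm, ← Polynomial.natDegree_mul hα0 hm0, ← Polynomial.natDegree_mul hγ0 hβ0,
      eq_neg_of_add_eq_zero_left hx, Polynomial.natDegree_neg]
  have hγ : γ = -aa L - α := by linear_combination hs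
  have h2 : β + δ - α * (aa L + α) = bb L := by
    rw [← hb, hγ]; ring
  have dγα : (α * γ).natDegree = α.natDegree + γ.natDegree := Polynomial.natDegree_mul hα0 hγ0
  have h3 : 3 ≤ max α.natDegree γ.natDegree := by
    have := Polynomial.natDegree_add_le α γ
    rwa [hs, Polynomial.natDegree_neg, da] at this
  by_cases hb3 : β.natDegree = 3
  · have h5 : (α * γ).natDegree ≤ 5 := by
      have : α * γ = bb L - (β + δ) := by linear_combination hb
      rw [this]
      have e1 := Polynomial.natDegree_sub_le (bb L) (β + δ)
      have e2 := Polynomial.natDegree_add_le β δ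
      omega
    omega
  · have hlt : β.natDegree < (mm L).natDegree := by omega
    have dmb : (mm L - β).natDegree = 3 := by
      rw [Polynomial.natDegree_sub_eq_left_of_natDegree_lt hlt, dm]
    have hmb0 := ne_of_deg dmb (by norm_num)
    have dα : α.natDegree = β.natDegree := by
      have := congrArg Polynomial.natDegree h1
      rw [Polynomial.natDegree_mul hα0 hmb0, Polynomial.natDegree_mul ha0 hβ0] at this
      omega
    have hcases : β.natDegree = 0 ∨ β.natDegree = 1 ∨ β.natDegree = 2 := by omega
    rcases hcases with h | h | h
    · have : δ = bb L - (β + α * γ) := by linear_combination hb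
      have e0 := congrArg Polynomial.natDegree this
      have e1 := Polynomial.natDegree_sub_le (bb L) (β + α * γ)
      have e2 := Polynomial.natDegree_add_le β (α * γ)
      omega
    · exact caseOne α β δ h1 h2 hp (by omega) h
    · exact caseTwo α β δ h1 h2 hp (by omega) h (by omega)

lemma quad_none (α β γ δ : L[X]) (hs : α + γ = -aa L) (hb : β + δ + α * γ = bb L)
    (hc : α * δ + β * γ = aa L * mm L) (hp : β * δ = mm L ^ 2) : False := by
  have hm0 : mm L ≠ 0 := ne_of_deg deg_mm (by norm_num)
  have h1 : (β + mm L) * (α * mm L + γ * β) = 0 := by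
    linear_combination β * hc - α * hp + mm L * β * hs
  rcases mul_eq_zero.1 h1 with h | h
  · have hβ : β = -mm L := by linear_combination h
    subst hβ
    have h2 : mm L * (δ + mm L) = 0 := by linear_combination -hp
    have h3 := (mul_eq_zero.1 h2).resolve_left hm0
    exact q_none (-α) (-γ) (by linear_combination -hs) (by linear_combination hb - h3)
  · have h2 : mm L * (γ * mm L + α * δ) = 0 := by
      linear_combination δ * h - γ * hp
    have h3 := (mul_eq_zero.1 h2).resolve_left hm0
    rcases le_total β.natDegree δ.natDegree with hle | hle
    · exact side α β γ δ hs hb hp h hle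
    · exact side γ δ α β (by linear_combination hs) (by linear_combination hb)
        (by linear_combination hp) h3 hle

/-- the polynomial in `L[t][X]` -/
def P (L : Type*) [Field L] : L[X][X] :=
  Polynomial.X ^ 4 - Polynomial.C (aa L) * Polynomial.X ^ 3 + Polynomial.C (bb L) * Polynomial.X ^ 2
    + Polynomial.C (aa L * mm L) * Polynomial.X + Polynomial.C (mm L ^ 2)

lemma P_deg : (P L).natDegree = 4 := by
  unfold P; compute_degree!

lemma P_monic : (P L).Monic := by
  unfold P; monicity!

lemma P_irr : Irreducible (P L) := by
  have hne : P L ≠ 1 := by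
    intro h
    have := P_deg (L := L)
    rw [h] at this; simp at this
  rw [P_monic.irreducible_iff_natDegree']
  refine ⟨hne, ?_⟩
  intro f g hf hg hfg hmem
  rw [P_deg, Finset.mem_Ioc] at hmem
  have hdf := congrArg Polynomial.natDegree hfg
  rw [hf.natDegree_mul hg, P_deg] at hdf
  have hcases : g.natDegree = 1 ∨ g.natDegree = 2 := by omega
  rcases hcases with h | h
  · have h1 : g = Polynomial.X + Polynomial.C (g.coeff 0) := hg.eq_X_add_C h
    have h2 := congrArg (Polynomial.eval (-(g.coeff 0))) hfg
    rw [Polynomial.eval_mul, h1] at h2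
    simp [P] at h2
    refine root_none (-(g.coeff 0)) ?_
    linear_combination -h2
  · have hfd : f.natDegree = 2 := by omega
    have form : ∀ u : L[X][X], u.Monic → u.natDegree = 2 →
        u = Polynomial.X ^ 2 + Polynomial.C (u.coeff 1) * Polynomial.X
          + Polynomial.C (u.coeff 0) := by
      intro u hu hd
      have := Polynomial.eq_quadratic_of_degree_le_two
        (Polynomial.natDegree_le_iff_degree_le.1 hd.le)
      have h2 : u.coeff 2 = 1 := by rw [← hd]; exact hu
      rw [h2, Polynomial.C_1, one_mul] at this
      exact this
    have e1 := form f hf hfd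
    have e2 := form g hg h
    generalize f.coeff 1 = α at e1
    generalize f.coeff 0 = β at e1
    generalize g.coeff 1 = γ at e2
    generalize g.coeff 0 = δ at e2
    have key : Polynomial.C (α + γ + aa L) * Polynomial.X ^ 3
      + Polynomial.C (β + δ + α * γ - bb L) * Polynomial.X ^ 2
      + Polynomial.C (α * δ + β * γ - aa L * mm L) * Polynomial.X
      + Polynomial.C (β * δ - mm L ^ 2) = 0 := by
      rw [← sub_eq_zero] at hfg
      rw [← hfg, e1, e2, P]
      simp only [map_add, map_sub, map_mul, map_pow]
      ring
    have c : ∀ k, _ := fun k => congrArg (fun w => Polynomial.coeff w k) key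
    have c0 := c 0
    have c1 := c 1
    have c2 := c 2
    have c3 := c 3
    simp only [Polynomial.coeff_add, Polynomial.coeff_C_mul, Polynomial.coeff_X_pow,
      Polynomial.coeff_X, Polynomial.coeff_C, Polynomial.coeff_zero] at c0 c1 c2 c3
    norm_num at c0 c1 c2 c3
    exact quad_none α β γ δ (by linear_combination c3) (by linear_combination c2)
      (by linear_combination c1) (by linear_combination c0)

end PAux

/-- Over an algebraically closed field of prime characteristic, `p(x,t)` is irreducible
in the two-variable polynomial ring. -/
theorem pPoly_irreducible (p : ℕ) (hp : p.Prime)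
    (L : Type*) [Field L] [IsAlgClosed L] [CharP L p] :
    Irreducible (pPoly L) := by
  let e := (MvPolynomial.finSuccEquiv L 1).trans
    (Polynomial.mapAlgEquiv (MvPolynomial.uniqueAlgEquiv L (Fin 1)))
  have h0 : e (X 0) = Polynomial.X := by
    simp [e, MvPolynomial.finSuccEquiv_X_zero]
  have h1 : e (X 1) = Polynomial.C Polynomial.X := by
    have : (1 : Fin 2) = Fin.succ 0 := rfl
    simp only [e, AlgEquiv.trans_apply, this, MvPolynomial.finSuccEquiv_X_succ]
    simp
  have h : e (pPoly L) = PAux.P L := by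
    simp only [pPoly, map_add, map_sub, map_mul, map_pow, map_neg, map_one, map_ofNat, h0, h1,
      PAux.P, PAux.aa, PAux.bb, PAux.mm]
    ring
  rw [← MulEquiv.irreducible_iff e, h]
  exact PAux.P_irr

end
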